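/- arXiv:2409.01363 — 2 statements merged into one kernel-verified Lean document; each statement's English description precedes it below -/
import Mathlib

section
/- Define Δ(Q,R) = Σ_{u∈V} Σ_{ℓ∈L} |d^ℓ_Q(u) − d^ℓ_R(u)| for colored multigraphs Q, R on the same vertex set V with the same coloring. If G and H are colored multigraphs on the same finite vertex set with the same coloring, with d_G(u) = d_H(u) for every vertex u and J_G = J_H, and Δ(G,H) > 0, then there exists a JDES transforming G into a multigraph T such that Δ(T,H) ≤ Δ(G,H) − 2. -/
open Multiset

variable {V L : Type*}

/-- Degree of a vertex in an edge multiset: number of edge-endpoint incidences,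
a self-loop contributing 2. -/
def mdeg [DecidableEq V] (E : Multiset (Sym2 V)) (u : V) : ℕ :=
  (E.map (Sym2.lift ⟨fun a b => (if a = u then 1 else 0) + (if b = u then 1 else 0),
    fun _ _ => add_comm _ _⟩)).sum

/-- Colored degree `d^ℓ(u)`: incidences of `u` with edges whose other endpoint has color `ℓ`;
a self-loop at `u` contributes 2 to `d^{lam u}(u)`. -/
def cdeg [DecidableEq V] [DecidableEq L] (lam : V → L) (E : Multiset (Sym2 V))
    (u : V) (ℓ : L) : ℕ :=
  (E.map (Sym2.lift ⟨fun a b =>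
      (if a = u ∧ lam b = ℓ then 1 else 0) + (if b = u ∧ lam a = ℓ then 1 else 0),
    fun _ _ => add_comm _ _⟩)).sum

/-- Joint color matrix entry `J[ℓ,r]`: number of edges (with multiplicity) whose endpoint
colors are `ℓ` and `r`. -/
def JCM [DecidableEq L] (lam : V → L) (E : Multiset (Sym2 V)) (ℓ r : L) : ℕ :=
  Multiset.count s(ℓ, r) (E.map (Sym2.map lam))

/-- Result of the double edge swap removing `(u,w),(v,z)` and adding `(u,z),(w,v)`. -/
def desApply [DecidableEq V] (E : Multiset (Sym2 V)) (u w v z : V) : Multiset (Sym2 V) :=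
  (E - {s(u,w), s(v,z)}) + {s(u,z), s(w,v)}

/-- The DES removing `(u,w),(v,z)` (two distinct members of `E`) and adding `(u,z),(w,v)`
is applicable to `E` and preserves the JCM. -/
def IsJDES [DecidableEq V] [DecidableEq L] (lam : V → L) (E : Multiset (Sym2 V))
    (u w v z : V) : Prop :=
  ({s(u,w), s(v,z)} : Multiset (Sym2 V)) ≤ E ∧
    ∀ ℓ r, JCM lam (desApply E u w v z) ℓ r = JCM lam E ℓ r

/-- One step of the JDES relation between edge multisets (on the same vertex set,
with the same coloring). -/
def JDESStep [DecidableEq V] [DecidableEq L] (lam : V → L)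
    (E E' : Multiset (Sym2 V)) : Prop :=
  ∃ u w v z, IsJDES lam E u w v z ∧ E' = desApply E u w v z

/-- Sub-multiset of edges incident to at least one vertex of color `ℓ`. -/
def EClass [DecidableEq L] (lam : V → L) (ℓ : L) (E : Multiset (Sym2 V)) :
    Multiset (Sym2 V) :=
  E.filter (fun e => ℓ ∈ Sym2.map lam e)

/-- `Δ(Q,R)`: total colored-degree discrepancy. -/
def Delta [Fintype V] [Fintype L] [DecidableEq V] [DecidableEq L]
    (lam : V → L) (E E' : Multiset (Sym2 V)) : ℕ :=
  ∑ u : V, ∑ ℓ : L, ((cdeg lam E u ℓ : ℤ) - (cdeg lam E' u ℓ : ℤ)).natAbs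

section ColoredDegrees

lemma JCM_cons [DecidableEq L] (lam : V → L) (E : Multiset (Sym2 V)) (a b : V) (ℓ r : L) :
    JCM lam (s(a, b) ::ₘ E) ℓ r
      = JCM lam E ℓ r + if s(ℓ, r) = s(lam a, lam b) then 1 else 0 := by
  simp [JCM, Multiset.count_cons]

variable [DecidableEq V]

lemma mdeg_cons (E : Multiset (Sym2 V)) (a b u : V) :
    mdeg (s(a, b) ::ₘ E) u
      = (if a = u then 1 else 0) + (if b = u then 1 else 0) + mdeg E u := by
  simp [mdeg]

variable [DecidableEq L] (lam : V → L)

lemma cdeg_cons (E : Multiset (Sym2 V)) (a b u : V) (ℓ : L) :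
    cdeg lam (s(a, b) ::ₘ E) u ℓ
      = (if a = u ∧ lam b = ℓ then 1 else 0) + (if b = u ∧ lam a = ℓ then 1 else 0)
        + cdeg lam E u ℓ := by
  simp [cdeg]

lemma sum_cdeg_eq_mdeg [Fintype L] (E : Multiset (Sym2 V)) (u : V) :
    ∑ ℓ : L, cdeg lam E u ℓ = mdeg E u := by
  induction E using Multiset.induction_on with
  | empty => simp [cdeg, mdeg]
  | cons e E ih =>
    induction e with | _ a b =>
    simp only [cdeg_cons, mdeg_cons, Finset.sum_add_distrib, ih]
    simp [ite_and]

/-- Summing the colored degrees towards `ℓ` over the vertices of color `c` counts the edges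
between the two color classes, twice when `c = ℓ`. -/
lemma sum_cdeg_eq_JCM [Fintype V] (E : Multiset (Sym2 V)) (c ℓ : L) :
    ∑ u : V, (if lam u = c then cdeg lam E u ℓ else 0)
      = if c = ℓ then 2 * JCM lam E c ℓ else JCM lam E c ℓ := by
  induction E using Multiset.induction_on with
  | empty => simp [cdeg, JCM]
  | cons e E ih =>
    induction e with | _ a b =>
    have h : ∀ u : V, (if lam u = c then cdeg lam (s(a, b) ::ₘ E) u ℓ else 0)
        = (if a = u then (if lam a = c ∧ lam b = ℓ then 1 else 0) else 0)
          + (if b = u then (if lam b = c ∧ lam a = ℓ then 1 else 0) else 0)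
          + (if lam u = c then cdeg lam E u ℓ else 0) := by
      intro u
      rw [cdeg_cons]
      grind
    simp only [h, Finset.sum_add_distrib, ih, JCM_cons, Finset.sum_ite_eq, Finset.mem_univ,
      if_true, Sym2.eq_iff]
    grind

lemma exists_mem_of_cdeg_pos {E : Multiset (Sym2 V)} {u : V} {ℓ : L}
    (h : 0 < cdeg lam E u ℓ) : ∃ w, s(u, w) ∈ E ∧ lam w = ℓ := by
  induction E using Multiset.induction_on with
  | empty => simp [cdeg] at h
  | cons e E ih =>
    induction e with | _ a b =>
    by_cases hE : 0 < cdeg lam E u ℓ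
    · obtain ⟨w, hw, hl⟩ := ih hE
      exact ⟨w, Multiset.mem_cons_of_mem hw, hl⟩
    · rw [cdeg_cons] at h
      by_cases h₁ : a = u ∧ lam b = ℓ
      · exact ⟨b, by simp [h₁.1], h₁.2⟩
      · have h₂ : b = u ∧ lam a = ℓ := by grind
        exact ⟨a, by simp [← h₂.1, Sym2.eq_swap], h₂.2⟩

lemma exists_desApply_eq {E : Multiset (Sym2 V)} {u w v z : V}
    (h : ({s(u, w), s(v, z)} : Multiset (Sym2 V)) ≤ E) :
    ∃ R, E = s(u, w) ::ₘ s(v, z) ::ₘ R ∧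
      desApply E u w v z = s(u, z) ::ₘ s(w, v) ::ₘ R := by
  obtain ⟨R, rfl⟩ := Multiset.le_iff_exists_add.mp h
  refine ⟨R, by simp, ?_⟩
  rw [desApply, add_tsub_cancel_left, add_comm]
  simp

lemma isJDES_of_color_eq {E : Multiset (Sym2 V)} {u w v z : V}
    (h : ({s(u, w), s(v, z)} : Multiset (Sym2 V)) ≤ E) (huv : lam u = lam v) :
    IsJDES lam E u w v z := by
  refine ⟨h, fun ℓ r => ?_⟩
  obtain ⟨R, hE, hT⟩ := exists_desApply_eq h
  rw [hT, hE]
  simp only [JCM_cons, huv, Sym2.eq_swap (a := lam w)]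
  ring

lemma cdeg_desApply_of_color_eq {E : Multiset (Sym2 V)} {u w v z : V}
    (h : ({s(u, w), s(v, z)} : Multiset (Sym2 V)) ≤ E) (huv : lam u = lam v) (x : V) (k : L) :
    cdeg lam (desApply E u w v z) x k
        + (if u = x ∧ lam w = k then 1 else 0) + (if v = x ∧ lam z = k then 1 else 0)
      = cdeg lam E x k
        + (if u = x ∧ lam z = k then 1 else 0) + (if v = x ∧ lam w = k then 1 else 0) := by
  obtain ⟨R, hE, hT⟩ := exists_desApply_eq h
  rw [hT, hE]
  simp only [cdeg_cons, huv]
  ring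

/-- A vertex with a surplus towards one color and a deficit towards another has a vertex of
its own color with a surplus towards the second color. -/
lemma exists_surplus_deficit [Fintype V] [Fintype L] {E E' : Multiset (Sym2 V)}
    (hdeg : ∀ u : V, mdeg E u = mdeg E' u)
    (hjcm : ∀ ℓ r : L, JCM lam E ℓ r = JCM lam E' ℓ r)
    (hpos : 0 < Delta lam E E') :
    ∃ (u v : V) (ℓ r : L), lam u = lam v ∧ cdeg lam E' u ℓ < cdeg lam E u ℓ ∧
      cdeg lam E u r < cdeg lam E' u r ∧ cdeg lam E' v r < cdeg lam E v r := by
  obtain ⟨u, -, hu⟩ := Finset.exists_ne_zero_of_sum_ne_zero hpos.ne'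
  obtain ⟨k, -, hk⟩ := Finset.exists_ne_zero_of_sum_ne_zero hu
  have hrow : ∑ ℓ : L, cdeg lam E u ℓ = ∑ ℓ : L, cdeg lam E' u ℓ := by
    rw [sum_cdeg_eq_mdeg, sum_cdeg_eq_mdeg, hdeg]
  have hne : cdeg lam E u k ≠ cdeg lam E' u k := by omega
  have hℓ : ∃ ℓ, cdeg lam E' u ℓ < cdeg lam E u ℓ := by
    by_contra! hle
    exact hne ((Finset.sum_eq_sum_iff_of_le fun i _ => hle i).mp hrow k (Finset.mem_univ k))
  have hr : ∃ r, cdeg lam E u r < cdeg lam E' u r := by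
    by_contra! hle
    exact hne.symm
      ((Finset.sum_eq_sum_iff_of_le fun i _ => hle i).mp hrow.symm k (Finset.mem_univ k))
  obtain ⟨ℓ, hℓ⟩ := hℓ
  obtain ⟨r, hr⟩ := hr
  have hcol : ∑ x : V, (if lam x = lam u then cdeg lam E x r else 0)
      = ∑ x : V, (if lam x = lam u then cdeg lam E' x r else 0) := by
    rw [sum_cdeg_eq_JCM, sum_cdeg_eq_JCM, hjcm]
  obtain ⟨v, -, hv⟩ : ∃ v ∈ Finset.univ, (if lam v = lam u then cdeg lam E' v r else 0)
      < (if lam v = lam u then cdeg lam E v r else 0) := by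
    by_contra! hle
    have := (Finset.sum_eq_sum_iff_of_le hle).mp hcol u (Finset.mem_univ u)
    simp only [if_true] at this
    omega
  by_cases hc : lam v = lam u
  · simp only [hc, if_true] at hv
    exact ⟨u, v, ℓ, r, hc.symm, hℓ, hr, hv⟩
  · simp [hc] at hv

end ColoredDegrees

/-- If `G` and `H` have the same degree sequence and the same JCM and
`Δ(G,H) > 0`, then some JDES applied to `G` yields `T` with `Δ(T,H) ≤ Δ(G,H) − 2`. -/
theorem delta_decreasing_jdes {V L : Type*} [Fintype V] [Fintype L] [DecidableEq V]
    [DecidableEq L] (lam : V → L) (E E' : Multiset (Sym2 V))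
    (hdeg : ∀ u : V, mdeg E u = mdeg E' u)
    (hjcm : ∀ ℓ r : L, JCM lam E ℓ r = JCM lam E' ℓ r)
    (hpos : 0 < Delta lam E E') :
    ∃ u w v z : V, IsJDES lam E u w v z ∧
      Delta lam (desApply E u w v z) E' + 2 ≤ Delta lam E E' := by
  obtain ⟨u, v, ℓ, r, huv, hℓ, hr, hv⟩ := exists_surplus_deficit lam hdeg hjcm hpos
  obtain ⟨w, hw, rfl⟩ := exists_mem_of_cdeg_pos lam (Nat.zero_lt_of_lt hℓ)
  obtain ⟨z, hz, rfl⟩ := exists_mem_of_cdeg_pos lam (Nat.zero_lt_of_lt hv)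
  have hwz : lam w ≠ lam z := fun h => by rw [h] at hℓ; omega
  have hne : s(u, w) ≠ s(v, z) := by
    rw [Ne, Sym2.eq_iff]
    grind
  have hle : ({s(u, w), s(v, z)} : Multiset (Sym2 V)) ≤ E := by
    refine (Multiset.le_iff_subset (by simpa using hne)).mpr fun e he => ?_
    rcases (by simpa using he : e = s(u, w) ∨ e = s(v, z)) with rfl | rfl <;> assumption
  refine ⟨u, w, v, z, isJDES_of_color_eq lam hle huv, ?_⟩
  have hpt : ∀ x k, ((cdeg lam (desApply E u w v z) x k : ℤ) - cdeg lam E' x k).natAbs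
        + (if u = x then if lam w = k then 1 else 0 else 0)
        + (if u = x then if lam z = k then 1 else 0 else 0)
        + (if v = x then if lam z = k then 1 else 0 else 0)
      ≤ ((cdeg lam E x k : ℤ) - cdeg lam E' x k).natAbs
        + (if v = x then if lam w = k then 1 else 0 else 0) := by
    intro x k
    have hT := cdeg_desApply_of_color_eq lam hle huv x k
    have huv' : u ≠ v := by rintro rfl; omega
    split_ifs <;> simp_all <;> omega
  have hsum := Finset.sum_le_sum fun x (_ : x ∈ Finset.univ) =>
    Finset.sum_le_sum fun k (_ : k ∈ Finset.univ) => hpt x k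
  simp only [Finset.sum_add_distrib] at hsum
  rw [← Delta, ← Delta] at hsum
  have hone : ∀ (a : V) (b : L),
      ∑ x : V, ∑ k : L, (if a = x then if b = k then 1 else 0 else 0) = 1 := by
    intro a b
    rw [Finset.sum_eq_single a (by simp +contextual [eq_comm]) (by simp)]
    simp
  simp only [hone] at hsum
  omega
end

section
/- Let (u,w) and (v,z) be distinct members of the edge multiset E of a colored multigraph G with u, w, v, z pairwise distinct and with at least three of the four colors λ(u), λ(w), λ(v), λ(z) equal to one another. Then the three DESs ⟨(u,w),(v,z) → (u,v),(w,z)⟩, ⟨(u,v),(w,z) → (u,z),(v,w)⟩, and ⟨(u,z),(v,w) → (u,w),(v,z)⟩ can be applied in this order starting from G, each of them is a JDES, and their composite returns the original multigraph G; hence the state space contains a closed walk of length 3 (in addition to the closed walks of length 2 given by reversibility of JDESs). -/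
open Multiset

variable {V L : Type*}

theorem desApply_pair_add [DecidableEq V] (F : Multiset (Sym2 V)) (u w v z : V) :
    desApply ({s(u,w), s(v,z)} + F) u w v z = {s(u,z), s(w,v)} + F := by
  rw [desApply, add_tsub_cancel_left, add_comm]

/-- A swap is a JDES if it keeps the color pairs of the two edges it touches: this is the case
when `u` and `v`, or `w` and `z`, have the same color. -/
theorem isJDES_pair_add [DecidableEq V] [DecidableEq L] (lam : V → L) (F : Multiset (Sym2 V))
    (u w v z : V) (h : lam u = lam v ∨ lam w = lam z) :
    IsJDES lam ({s(u,w), s(v,z)} + F) u w v z := by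
  refine ⟨Multiset.le_add_right _ _, fun ℓ r => ?_⟩
  have hpair : ({s(lam u, lam z), s(lam w, lam v)} : Multiset (Sym2 L)) =
      {s(lam u, lam w), s(lam v, lam z)} := by
    rcases h with h | h
    · rw [h, Sym2.eq_swap (a := lam w), Multiset.pair_comm]
    · rw [h, Sym2.eq_swap (a := lam z) (b := lam v)]
  rw [desApply_pair_add]
  simp only [JCM, Multiset.map_add, Multiset.insert_eq_cons, Multiset.map_cons,
    Multiset.map_singleton, Sym2.map_mk] at hpair ⊢
  rw [hpair]

/-- In Case 4C (four pairwise distinct vertices, at least three of the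
four colors equal), the three DESs `⟨(u,w),(v,z) → (u,v),(w,z)⟩`,
`⟨(u,v),(w,z) → (u,z),(v,w)⟩`, `⟨(u,z),(v,w) → (u,w),(v,z)⟩` can be applied in this
order, each is a JDES, and their composite returns the original multigraph: a closed
walk of length 3 in the state space. -/
theorem case4C_triangle {V L : Type*} [DecidableEq V] [DecidableEq L]
    (lam : V → L) (E : Multiset (Sym2 V)) (u w v z : V)
    (h1 : s(u,w) ∈ E) (h2 : s(v,z) ∈ E)
    (hdist : ([u, w, v, z] : List V).Pairwise (· ≠ ·))
    (hcol : (lam u = lam w ∧ lam u = lam v) ∨ (lam u = lam w ∧ lam u = lam z) ∨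
      (lam u = lam v ∧ lam u = lam z) ∨ (lam w = lam v ∧ lam w = lam z)) :
    IsJDES lam E u w z v ∧
      IsJDES lam (desApply E u w z v) u v w z ∧
      IsJDES lam (desApply (desApply E u w z v) u v w z) u z v w ∧
      desApply (desApply (desApply E u w z v) u v w z) u z v w = E := by
  have huvz : s(v,z) ≠ s(u,w) := by
    simp only [List.pairwise_cons, List.mem_cons] at hdist
    grind
  obtain ⟨E', rfl⟩ := Multiset.exists_cons_of_mem h1
  obtain ⟨F, rfl⟩ := Multiset.exists_cons_of_mem
    ((Multiset.mem_cons.mp h2).resolve_left huvz)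
  have hE : s(u,w) ::ₘ s(v,z) ::ₘ F = {s(u,w), s(z,v)} + F := by
    simp [Sym2.eq_swap (a := v)]
  have step₁ := desApply_pair_add F u w z v
  have step₂ := desApply_pair_add F u v w z
  have step₃ := desApply_pair_add F u z v w
  rw [hE, step₁, step₂, step₃]
  refine ⟨isJDES_pair_add lam F u w z v ?_, isJDES_pair_add lam F u v w z ?_,
    isJDES_pair_add lam F u z v w ?_, rfl⟩ <;> grind
end
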